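/- arXiv:2110.05558 — 2 statements merged into one kernel-verified Lean document; each statement's English description precedes it below -/
import Mathlib

section
/- Let K be an algebraically closed field of characteristic zero and F ∈ K[y, y'] an irreducible differential polynomial. If the autonomous differential equation F(y, y') = 0 admits one non-constant formal Puiseux series solution that is algebraic over K(x), then every non-constant formal Puiseux series solution of F(y, y') = 0 is algebraic over K(x). -/
open Polynomial

/-- The formal derivative of a Hahn/Puiseux series: the coefficient of `x^q`
in `f'` is `(q+1) · (coefficient of `x^{q+1}` in `f`)`. -/
noncomputable def pDeriv {K : Type*} [Field K] [CharZero K] (f : HahnSeries ℚ K) :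
    HahnSeries ℚ K where
  coeff q := (q + 1 : ℚ) • f.coeff (q + 1)
  isPWO_support' := by
    have hsub : (Function.support fun q : ℚ => (q + 1 : ℚ) • f.coeff (q + 1)) ⊆
        (fun q : ℚ => q - 1) '' f.support := by
      intro q hq
      refine ⟨q + 1, ?_, by ring⟩
      intro h
      simp [Function.mem_support, h] at hq
    exact (f.isPWO_support.image_of_monotone
      (fun a b hab => by simpa using sub_le_sub_right hab 1)).mono hsub

/-- A Hahn series over `ℚ` is a (formal) Puiseux series if the exponents in its
support have a common denominator. -/
def IsPuiseux {K : Type*} [Field K] (f : HahnSeries ℚ K) : Prop :=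
  ∃ n : ℕ, 0 < n ∧ ∀ q ∈ f.support, ∃ m : ℤ, q = (m : ℚ) / n


/-- The Puiseux series `x`. -/
noncomputable def Xser (K : Type*) [Field K] : HahnSeries ℚ K := HahnSeries.single (1 : ℚ) 1

/-- `y(x)` is algebraic over `K(x)`: there is a nonzero bivariate polynomial
`Q(x,y)` with `Q(x, y(x)) = 0` (variable `0` is `x`, variable `1` is `y`). -/
def AlgebraicOverKx {K : Type*} [Field K] [CharZero K] (y : HahnSeries ℚ K) : Prop :=
  ∃ Q : MvPolynomial (Fin 2) K, Q ≠ 0 ∧ MvPolynomial.aeval ![Xser K, y] Q = 0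

namespace S3

open Polynomial

section gen
variable {K E : Type*} [Field K] [Field E] [Algebra K E]

lemma aeval_equiv (a b : E) (P : K[X][X]) :
    MvPolynomial.aeval ![a, b] (Polynomial.Bivariate.equivMvPolynomial K P) =
      Polynomial.eval₂ (Polynomial.aeval a : K[X] →ₐ[K] E).toRingHom b P := by
  induction P using Polynomial.induction_on' with
  | add p q hp hq => simp [hp, hq, Polynomial.eval₂_add]
  | monomial n p =>
    induction p using Polynomial.induction_on' with
    | add p q hp hq => simp only [map_add, hp, hq, Polynomial.eval₂_add]
    | monomial m c =>
      simp_rw [← Polynomial.C_mul_X_pow_eq_monomial]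
      simp [Polynomial.eval₂_mul, Polynomial.eval₂_pow, MvPolynomial.algebraMap_eq]

lemma ker_biv {a b : E} (ha : Transcendental K a) {P Q : K[X][X]} (hP : Irreducible P)
    (hPa : Polynomial.eval₂ (Polynomial.aeval a : K[X] →ₐ[K] E).toRingHom b P = 0)
    (hQa : Polynomial.eval₂ (Polynomial.aeval a : K[X] →ₐ[K] E).toRingHom b Q = 0) :
    P.natDegree ≠ 0 ∧ P ∣ Q := by
  have hinj : Function.Injective (Polynomial.aeval a : K[X] →ₐ[K] E).toRingHom :=
    transcendental_iff_injective.mp ha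
  have hd : P.natDegree ≠ 0 := by
    intro h
    obtain ⟨c, rfl⟩ := Polynomial.natDegree_eq_zero.mp h
    rw [Polynomial.eval₂_C] at hPa
    have : c = 0 := hinj (by rw [hPa, map_zero])
    exact hP.ne_zero (by simp [this])
  refine ⟨hd, ?_⟩
  have hprim := hP.isPrimitive hd
  classical
  letI : NormalizedGCDMonoid K[X] := Classical.choice inferInstance
  by_contra hnd
  rw [hprim.dvd_iff_fraction_map_dvd_fraction_map (FractionRing K[X])] at hnd
  have hirr := (hprim.irreducible_iff_irreducible_map_fraction_map
    (K := FractionRing K[X])).mp hP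
  obtain ⟨u, v, huv⟩ := (hirr.coprime_iff_not_dvd).mpr hnd
  have key := congrArg (Polynomial.eval₂ (IsFractionRing.lift (K := FractionRing K[X]) hinj) b) huv
  have hc : (IsFractionRing.lift (K := FractionRing K[X]) hinj).comp
      (algebraMap K[X] (FractionRing K[X])) = (Polynomial.aeval a : K[X] →ₐ[K] E).toRingHom := by
    ext <;> simp
  rw [Polynomial.eval₂_add, Polynomial.eval₂_mul, Polynomial.eval₂_mul, Polynomial.eval₂_map,
    Polynomial.eval₂_map, hc, hPa, hQa] at key
  simp at key

lemma ker_mv {a b : E} (ha : Transcendental K a) {F G : MvPolynomial (Fin 2) K}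
    (hF : Irreducible F) (hFa : MvPolynomial.aeval ![a, b] F = 0)
    (hGa : MvPolynomial.aeval ![a, b] G = 0) : F ∣ G := by
  obtain ⟨P, rfl⟩ := (Polynomial.Bivariate.equivMvPolynomial K).surjective F
  obtain ⟨Q, rfl⟩ := (Polynomial.Bivariate.equivMvPolynomial K).surjective G
  rw [aeval_equiv] at hFa hGa
  exact map_dvd _ (ker_biv ha ((MulEquiv.irreducible_iff _).mp hF) hFa hGa).2

lemma sep_mv [CharZero K] {a b : E} (ha : Transcendental K a) {F : MvPolynomial (Fin 2) K}
    (hF : Irreducible F) (hFa : MvPolynomial.aeval ![a, b] F = 0) :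
    MvPolynomial.aeval ![a, b] (MvPolynomial.pderiv 1 F) ≠ 0 := by
  obtain ⟨P, rfl⟩ := (Polynomial.Bivariate.equivMvPolynomial K).surjective F
  rw [Polynomial.Bivariate.pderiv_one_equivMvPolynomial, aeval_equiv]
  rw [aeval_equiv] at hFa
  intro h
  obtain ⟨hd, hdvd⟩ := ker_biv ha ((MulEquiv.irreducible_iff _).mp hF) hFa h
  have h0 : Polynomial.derivative P = 0 := by
    by_contra hne
    have := Polynomial.natDegree_le_of_dvd hdvd hne
    have := Polynomial.natDegree_derivative_lt hd
    omega
  exact hd (Polynomial.natDegree_eq_zero_of_derivative_eq_zero h0)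

lemma dep_iff {a b : E} (hb : Transcendental K b) :
    (∃ Q : MvPolynomial (Fin 2) K, Q ≠ 0 ∧ MvPolynomial.aeval ![a, b] Q = 0) ↔
      IsAlgebraic (IntermediateField.adjoin K {b}) a := by
  have h1 : (∃ Q : MvPolynomial (Fin 2) K, Q ≠ 0 ∧ MvPolynomial.aeval ![a, b] Q = 0) ↔
      ¬ AlgebraicIndependent K ![a, b] := by
    rw [algebraicIndependent_iff]
    push Not
    exact ⟨fun ⟨Q, h, h'⟩ => ⟨Q, h', h⟩, fun ⟨Q, h, h'⟩ => ⟨Q, h', h⟩⟩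
  have himg : (![a, b] '' {0}ᶜ : Set E) = {b} := by
    ext t; simp [Fin.exists_fin_two, eq_comm]
  have h2 : AlgebraicIndependent K (fun j : {j : Fin 2 // j ≠ 0} ↦ ![a, b] j) := by
    haveI : Subsingleton {j : Fin 2 // j ≠ 0} := ⟨by decide⟩
    rw [algebraicIndependent_singleton_iff (⟨1, by decide⟩ : {j : Fin 2 // j ≠ 0})]
    simpa using hb
  rw [h1, AlgebraicIndependent.iff_transcendental_adjoin_image 0, himg]
  simp only [h2, true_and, Transcendental, not_not]
  open scoped IntermediateField.algebraAdjoinAdjoin in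
  exact IsFractionRing.isAlgebraic_iff (Algebra.adjoin K {b}) (IntermediateField.adjoin K {b}) E

lemma D_aeval (D : Derivation K E E) (a b : E) (P : MvPolynomial (Fin 2) K) :
    D (MvPolynomial.aeval ![a, b] P) =
      MvPolynomial.aeval ![a, b] (MvPolynomial.pderiv 0 P) * D a +
      MvPolynomial.aeval ![a, b] (MvPolynomial.pderiv 1 P) * D b := by
  induction P using MvPolynomial.induction_on with
  | C c => simp
  | add p q hp hq => simp only [map_add, hp, hq]; ring
  | mul_X p i hp =>
    fin_cases i <;>
    simp [hp, MvPolynomial.pderiv_X, Derivation.leibniz, Pi.single_apply] <;> ring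

/-- the differential polynomial expression for `F₂ · D`. -/
noncomputable def Del (F P : MvPolynomial (Fin 2) K) : MvPolynomial (Fin 2) K :=
  MvPolynomial.X 1 * (MvPolynomial.pderiv 0 P * MvPolynomial.pderiv 1 F
    - MvPolynomial.pderiv 1 P * MvPolynomial.pderiv 0 F)

lemma D_Del (D : Derivation K E E) {a : E} {F : MvPolynomial (Fin 2) K}
    (hFa : MvPolynomial.aeval ![a, D a] F = 0) (P : MvPolynomial (Fin 2) K) :
    MvPolynomial.aeval ![a, D a] (MvPolynomial.pderiv 1 F) * D (MvPolynomial.aeval ![a, D a] P) =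
      MvPolynomial.aeval ![a, D a] (Del F P) := by
  have h := D_aeval D a (D a) F
  rw [hFa, map_zero] at h
  rw [D_aeval]
  simp only [Del, map_mul, map_sub, MvPolynomial.aeval_X]
  simp only [Matrix.cons_val_one, Matrix.cons_val_fin_one]
  linear_combination (-MvPolynomial.aeval ![a, D a] (MvPolynomial.pderiv 1 P)) * h

lemma D_div_iff [CharZero K] (D : Derivation K E E) {a : E} (ha : Transcendental K a)
    {F : MvPolynomial (Fin 2) K} (hF : Irreducible F)
    (hFa : MvPolynomial.aeval ![a, D a] F = 0) (P R : MvPolynomial (Fin 2) K)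
    (hR : MvPolynomial.aeval ![a, D a] R ≠ 0) :
    D (MvPolynomial.aeval ![a, D a] P / MvPolynomial.aeval ![a, D a] R) = 1 ↔
      F ∣ Del F P * R - P * Del F R - MvPolynomial.pderiv 1 F * R ^ 2 := by
  have hs := sep_mv ha hF hFa
  have h1 : F ∣ Del F P * R - P * Del F R - MvPolynomial.pderiv 1 F * R ^ 2 ↔
      MvPolynomial.aeval ![a, D a]
        (Del F P * R - P * Del F R - MvPolynomial.pderiv 1 F * R ^ 2) = 0 := by
    refine ⟨?_, ker_mv ha hF hFa⟩
    rintro ⟨G, hG⟩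
    rw [hG, map_mul, hFa, zero_mul]
  rw [h1, Derivation.leibniz_div]
  simp only [map_sub, map_mul, map_pow, ← D_Del D hFa, smul_eq_mul]
  field_simp
  constructor
  · intro h; linear_combination (MvPolynomial.aeval ![a, D a] (MvPolynomial.pderiv 1 F)) * h
  · intro h
    apply mul_left_cancel₀ hs
    linear_combination h

/-- If `x` is algebraic over a differential subfield with `D x = 1`, the subfield has such an
element. -/
lemma exists_one [CharZero K] (D : Derivation K E E) (L : IntermediateField K E)
    (hL : ∀ u ∈ L, D u ∈ L) {x : E} (hx : IsAlgebraic L x) (hDx : D x = 1) :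
    ∃ u ∈ L, D u = 1 := by
  have hint : IsIntegral L x := hx.isIntegral
  set p := minpoly L x with hp
  have hm : p.Monic := minpoly.monic hint
  set n := p.natDegree with hn
  have hn0 : 0 < n := minpoly.natDegree_pos hint
  let d : L → L := fun u => ⟨D u, hL u u.2⟩
  let q : L[X] := ∑ i ∈ Finset.range n, C (d (p.coeff i)) * X ^ i
  have hsum : x ^ n + ∑ i ∈ Finset.range n, (p.coeff i : E) * x ^ i = 0 := by
    have h := minpoly.aeval L x
    rw [← hp, hm.as_sum] at h
    simpa [← hn, IntermediateField.algebraMap_apply] using h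
  have hq : aeval x (derivative p + q) = 0 := by
    have h := congrArg D hsum
    rw [hm.as_sum]
    simp only [map_add, map_sum, Derivation.leibniz, Derivation.leibniz_pow, hDx, map_zero] at h
    simp only [q, map_add, map_sum, derivative_mul, derivative_X_pow, derivative_C, map_mul,
      aeval_C, aeval_X, map_pow, zero_mul, zero_add, ← hn]
    rw [← h, add_assoc, ← Finset.sum_add_distrib]
    congr 1
    · simp
    · refine Finset.sum_congr rfl fun i _ => ?_
      simp [d, IntermediateField.algebraMap_apply]
      ring
  have hqdeg : q.degree < p.degree := by
    rw [Polynomial.degree_eq_natDegree hm.ne_zero, ← hn]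
    refine (Polynomial.degree_lt_iff_coeff_zero _ _).mpr fun m hm' => ?_
    simp only [q, finsetSum_coeff, coeff_C_mul_X_pow]
    rw [Finset.sum_ite_eq, if_neg (by simpa using hm')]
  have hdeg : (derivative p + q).degree < p.degree :=
    (Polynomial.degree_add_le _ _).trans_lt
      (max_lt (Polynomial.degree_derivative_lt hm.ne_zero) hqdeg)
  have h0 : derivative p + q = 0 := by
    by_contra hne
    exact absurd (minpoly.degree_le_of_ne_zero L x hne hq) (not_le.mpr hdeg)
  have hc := congrArg (fun r => r.coeff (n - 1)) h0
  have hcn : p.coeff n = 1 := hm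
  simp only [q, coeff_add, coeff_derivative, finsetSum_coeff, coeff_C_mul_X_pow, coeff_zero,
    Nat.sub_add_cancel hn0, hcn] at hc
  rw [Finset.sum_ite_eq, if_pos (Finset.mem_range.mpr (by omega))] at hc
  have hcE := congrArg (algebraMap L E) hc
  have hcast : ((n - 1 : ℕ) : E) + 1 = n := by
    rw [← Nat.cast_succ, Nat.succ_eq_add_one, Nat.sub_add_cancel hn0]
  simp [d, IntermediateField.algebraMap_apply, hcast] at hcE
  haveI : CharZero E := charZero_of_injective_algebraMap (algebraMap K E).injective
  have hnE : (n : E) ≠ 0 := by exact_mod_cast hn0.ne'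
  refine ⟨algebraMap K E (-(n : K)⁻¹) * p.coeff (n - 1),
    L.mul_mem (L.algebraMap_mem _) (p.coeff (n - 1)).2, ?_⟩
  rw [Derivation.leibniz, Derivation.map_algebraMap]
  have h3 : D (p.coeff (n - 1) : E) = -n := by linear_combination hcE
  simp [h3, hnE]

lemma D_stable [CharZero K] (D : Derivation K E E) {a : E} (ha : Transcendental K a)
    {F : MvPolynomial (Fin 2) K} (hF : Irreducible F)
    (hFa : MvPolynomial.aeval ![a, D a] F = 0) :
    ∀ u ∈ IntermediateField.adjoin K (Set.range ![a, D a]),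
      D u ∈ IntermediateField.adjoin K (Set.range ![a, D a]) := by
  have hs := sep_mv ha hF hFa
  have hmem : ∀ P : MvPolynomial (Fin 2) K, MvPolynomial.aeval ![a, D a] P ∈
      IntermediateField.adjoin K (Set.range ![a, D a]) := fun P =>
    (IntermediateField.mem_adjoin_range_iff K _ _).mpr ⟨P, 1, by simp⟩
  have hD : ∀ P : MvPolynomial (Fin 2) K, D (MvPolynomial.aeval ![a, D a] P) ∈
      IntermediateField.adjoin K (Set.range ![a, D a]) := by
    intro P
    have : D (MvPolynomial.aeval ![a, D a] P) = MvPolynomial.aeval ![a, D a] (Del F P) /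
        MvPolynomial.aeval ![a, D a] (MvPolynomial.pderiv 1 F) := by
      rw [← D_Del D hFa]; field_simp
    rw [this]
    exact div_mem (hmem _) (hmem _)
  intro u hu
  obtain ⟨P, R, rfl⟩ := (IntermediateField.mem_adjoin_range_iff K _ _).mp hu
  rw [Derivation.leibniz_div]
  simp only [smul_eq_mul]
  exact mul_mem (pow_mem (inv_mem (hmem _)) _) (sub_mem (mul_mem (hmem _) (hD _)) (mul_mem (hmem _) (hD _)))

theorem main [CharZero K] (D : Derivation K E E) (hker : ∀ u, D u = 0 → ∃ c, u = algebraMap K E c)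
    {x y z : E} (hx : D x = 1) (hy : Transcendental K y) (hz : Transcendental K z)
    {F : MvPolynomial (Fin 2) K} (hF : Irreducible F)
    (hFy : MvPolynomial.aeval ![y, D y] F = 0) (hFz : MvPolynomial.aeval ![z, D z] F = 0)
    (hxy : ∃ Q : MvPolynomial (Fin 2) K, Q ≠ 0 ∧ MvPolynomial.aeval ![x, y] Q = 0) :
    ∃ Q : MvPolynomial (Fin 2) K, Q ≠ 0 ∧ MvPolynomial.aeval ![x, z] Q = 0 := by
  rw [dep_iff hy] at hxy
  rw [dep_iff hz]
  set L := IntermediateField.adjoin K (Set.range ![y, D y]) with hLdef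
  have hle : IntermediateField.adjoin K {y} ≤ L := by
    rw [IntermediateField.adjoin_simple_le_iff]
    exact IntermediateField.subset_adjoin _ _ ⟨0, rfl⟩
  have hxL : IsAlgebraic L x := by
    obtain ⟨p, hp, hpx⟩ := hxy
    refine ⟨p.map (IntermediateField.inclusion hle).toRingHom,
      (Polynomial.map_ne_zero_iff (IntermediateField.inclusion hle).toRingHom.injective).mpr hp, ?_⟩
    rw [aeval_def, eval₂_map]
    exact hpx
  obtain ⟨u, huL, hu⟩ := exists_one D L (D_stable D hy hF hFy) hxL hx
  obtain ⟨P, R, rfl⟩ := (IntermediateField.mem_adjoin_range_iff K _ _).mp huL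
  have hRy : MvPolynomial.aeval ![y, D y] R ≠ 0 := by
    intro h; simp [h] at hu
  have hRz : MvPolynomial.aeval ![z, D z] R ≠ 0 := by
    intro h
    obtain ⟨G, rfl⟩ := ker_mv hz hF hFz h
    exact hRy (by rw [map_mul, hFy, zero_mul])
  have hu' := (D_div_iff D hz hF hFz P R hRz).mpr ((D_div_iff D hy hF hFy P R hRy).mp hu)
  obtain ⟨c, hc⟩ := hker (x - MvPolynomial.aeval ![z, D z] P / MvPolynomial.aeval ![z, D z] R)
    (by rw [map_sub, hx, hu', sub_self])
  set M := IntermediateField.adjoin K {z}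
  have hzM : z ∈ M := IntermediateField.mem_adjoin_simple_self K z
  have hz1 : IsAlgebraic M z := isAlgebraic_algebraMap (⟨z, hzM⟩ : M)
  have hz2 : IsAlgebraic M (D z) := by
    rw [← dep_iff hz]
    refine ⟨MvPolynomial.rename (Equiv.swap 0 1) F, ?_, ?_⟩
    · rw [Ne, MvPolynomial.rename_eq_zero_iff_of_injective _ (Equiv.injective _)]
      exact hF.ne_zero
    · rw [MvPolynomial.aeval_rename, ← hFz]
      congr 2
      ext i
      fin_cases i <;> simp
  have halg : ∀ P : MvPolynomial (Fin 2) K, IsAlgebraic M (MvPolynomial.aeval ![z, D z] P) := by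
    intro P
    induction P using MvPolynomial.induction_on with
    | C c =>
      simpa using isAlgebraic_algebraMap (A := E) (algebraMap K M c)
    | add p q hp hq => rw [map_add]; exact hp.add hq
    | mul_X p i hp =>
      rw [map_mul]
      refine hp.mul ?_
      fin_cases i
      · simpa using hz1
      · simpa using hz2
  have : x = algebraMap M E (algebraMap K M c) +
      MvPolynomial.aeval ![z, D z] P / MvPolynomial.aeval ![z, D z] R := by
    rw [← IsScalarTower.algebraMap_apply, ← hc]; ring
  rw [this, div_eq_mul_inv]
  exact (isAlgebraic_algebraMap _).add ((halg P).mul (halg R).inv)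

theorem main' [CharZero K] (D : E → E) (hadd : ∀ u v, D (u + v) = D u + D v)
    (hmul : ∀ u v, D (u * v) = u * D v + v * D u) (hconst : ∀ c, D (algebraMap K E c) = 0)
    (hker : ∀ u, D u = 0 → ∃ c, u = algebraMap K E c)
    {x y z : E} (hx : D x = 1) (hy : Transcendental K y) (hz : Transcendental K z)
    {F : MvPolynomial (Fin 2) K} (hF : Irreducible F)
    (hFy : MvPolynomial.aeval ![y, D y] F = 0) (hFz : MvPolynomial.aeval ![z, D z] F = 0)
    (hxy : ∃ Q : MvPolynomial (Fin 2) K, Q ≠ 0 ∧ MvPolynomial.aeval ![x, y] Q = 0) :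
    ∃ Q : MvPolynomial (Fin 2) K, Q ≠ 0 ∧ MvPolynomial.aeval ![x, z] Q = 0 :=
  main (Derivation.mk'
    { toFun := D
      map_add' := hadd
      map_smul' := by
        intro c f; simp [Algebra.smul_def, hmul, hconst] } hmul) hker hx hy hz hF hFy hFz hxy

end gen

section hahn
variable {K : Type*} [Field K] [CharZero K]

/-- Euler derivation. -/
noncomputable def theta (f : HahnSeries ℚ K) : HahnSeries ℚ K where
  coeff q := (q : K) * f.coeff q
  isPWO_support' := f.isPWO_support.mono (by
    intro q hq h
    simp [h] at hq)

lemma theta_coeff (f : HahnSeries ℚ K) (q : ℚ) : (theta f).coeff q = (q : K) * f.coeff q := rfl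

lemma theta_support (f : HahnSeries ℚ K) : (theta f).support ⊆ f.support := by
  intro q hq h
  simp [theta_coeff, h] at hq

lemma theta_mul (f g : HahnSeries ℚ K) : theta (f * g) = f * theta g + g * theta f := by
  ext q
  rw [mul_comm g, HahnSeries.coeff_add, theta_coeff, HahnSeries.coeff_mul,
    HahnSeries.coeff_mul_right' g.isPWO_support (theta_support g),
    HahnSeries.coeff_mul_left' f.isPWO_support (theta_support f), ← Finset.sum_add_distrib,
    Finset.mul_sum]
  refine Finset.sum_congr rfl fun ij hij => ?_
  have h : ij.1 + ij.2 = q := by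
    simp at hij
    exact hij.2.2
  rw [theta_coeff, theta_coeff, ← h]
  push_cast
  ring

lemma pDeriv_eq (f : HahnSeries ℚ K) :
    pDeriv f = HahnSeries.single (-1 : ℚ) 1 * theta f := by
  ext q
  rw [HahnSeries.coeff_single_mul, theta_coeff]
  simp [pDeriv, Rat.smul_def]

lemma algMap (c : K) : algebraMap K (HahnSeries ℚ K) c = HahnSeries.C c := by
  rw [HahnSeries.algebraMap_apply']
  exact HahnSeries.ofPowerSeries_C c

lemma pDeriv_add (f g : HahnSeries ℚ K) : pDeriv (f + g) = pDeriv f + pDeriv g := by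
  ext q; simp [pDeriv]

lemma pDeriv_mul (f g : HahnSeries ℚ K) : pDeriv (f * g) = f * pDeriv g + g * pDeriv f := by
  simp only [pDeriv_eq, theta_mul]
  ring

lemma pDeriv_const (c : K) : pDeriv (algebraMap K (HahnSeries ℚ K) c) = 0 := by
  rw [algMap]
  ext q
  by_cases h : q + 1 = 0
  · simp [pDeriv, h]
  · simp [pDeriv, HahnSeries.C_apply, HahnSeries.coeff_single, h]

lemma pDeriv_X : pDeriv (Xser K) = 1 := by
  ext q
  simp only [pDeriv, Xser, HahnSeries.coeff_single, HahnSeries.coeff_one]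
  by_cases h : q = 0
  · simp [h]
  · simp [h]

lemma pDeriv_ker (f : HahnSeries ℚ K) (h : pDeriv f = 0) :
    ∃ c : K, f = algebraMap K (HahnSeries ℚ K) c := by
  refine ⟨f.coeff 0, ?_⟩
  rw [algMap]
  ext q
  have := congrArg (fun g => HahnSeries.coeff g (q - 1)) h
  simp [pDeriv] at this
  by_cases hq : q = 0
  · simp [hq]
  · simpa [hq, HahnSeries.C_apply, HahnSeries.coeff_single] using this

lemma transc [IsAlgClosed K] (f : HahnSeries ℚ K) (h : ∀ c : K, f ≠ HahnSeries.C c) :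
    Transcendental K f := by
  intro ha
  obtain ⟨c, hc⟩ := minpoly.mem_range_of_degree_eq_one K f
    (IsAlgClosed.degree_eq_one_of_irreducible K (minpoly.irreducible ha.isIntegral))
  exact h c (by rw [← hc, algMap])

end hahn
end S3

theorem statement3 {K : Type*} [Field K] [IsAlgClosed K] [CharZero K]
    (F : MvPolynomial (Fin 2) K) (hF : Irreducible F)
    (hex : ∃ y : HahnSeries ℚ K, IsPuiseux y ∧ (∀ c : K, y ≠ HahnSeries.C c) ∧
      MvPolynomial.aeval ![y, pDeriv y] F = 0 ∧ AlgebraicOverKx y) :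
    ∀ z : HahnSeries ℚ K, IsPuiseux z → (∀ c : K, z ≠ HahnSeries.C c) →
      MvPolynomial.aeval ![z, pDeriv z] F = 0 → AlgebraicOverKx z := by

  obtain ⟨y, -, hyc, hFy, hya⟩ := hex
  intro z _ hzc hFz
  exact S3.main' pDeriv S3.pDeriv_add S3.pDeriv_mul S3.pDeriv_const S3.pDeriv_ker S3.pDeriv_X (S3.transc y hyc) (S3.transc z hzc) hF hFy hFz hya
end

section
/- Let K be an algebraically closed field of characteristic zero and F ∈ K[y, y'] irreducible. If y₁(x) and y₂(x) are non-constant algebraic Puiseux series solutions of F(y, y') = 0 with minimal polynomials Q₁, Q₂ ∈ K[x, y], then there exists c ∈ K such that Q₁(x, y) = Q₂(x + c, y). -/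
open Polynomial

/-- Evaluation of `Q ∈ K[x][y]` at `(x, y) = (Xser K, y)` in the Puiseux series field. -/
noncomputable def evalXY {K : Type*} [Field K] (Q : Polynomial (Polynomial K))
    (y : HahnSeries ℚ K) : HahnSeries ℚ K :=
  Polynomial.eval₂ (Polynomial.aeval (Xser K)).toRingHom y Q

/-- `Q ∈ K[x][y]` is the minimal polynomial of the Puiseux series `y(x)`:
it is monic (in `y`), irreducible and vanishes at `(x, y(x))`. -/
def IsMinPolyOf {K : Type*} [Field K] (Q : Polynomial (Polynomial K))
    (y : HahnSeries ℚ K) : Prop :=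
  Q.Monic ∧ Irreducible Q ∧ evalXY Q y = 0

section AuxAlg
open Polynomial

theorem aux_transc {K H : Type*} [Field K] [IsAlgClosed K] [Field H] [Algebra K H]
    (d : Derivation K H H) (y : H) (hy : d y ≠ 0) : Transcendental K y := by
  intro h
  have h1 : (minpoly K y).degree = 1 :=
    IsAlgClosed.degree_eq_one_of_irreducible K (minpoly.irreducible h.isIntegral)
  obtain ⟨c, hc⟩ := minpoly.mem_range_of_degree_eq_one K y h1
  exact hy (by rw [← hc]; simp)

theorem aux_eval {K H : Type*} [Field K] [Field H] [Algebra K H] (a b : H) (P : K[X][X]) :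
    aevalAeval a b P = eval₂ (aeval a : K[X] →ₐ[K] H).toRingHom b P := by
  induction P using Polynomial.induction_on' with
  | add p q hp hq => simp only [map_add, hp, hq, eval₂_add]
  | monomial n p => simp [← C_mul_X_pow_eq_monomial, eval₂_mul, eval₂_pow]

theorem aux_dvd {K H : Type*} [Field K] [Field H] [Algebra K H] (a b : H)
    (ha : Transcendental K a) (P G : K[X][X]) (hP : Irreducible P)
    (hPe : aevalAeval a b P = 0) (hG : aevalAeval a b G = 0) :
    P.natDegree ≠ 0 ∧ P ∣ G := by
  have hinj : Function.Injective (aeval a : K[X] →ₐ[K] H).toRingHom :=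
    transcendental_iff_injective.mp ha
  have hdeg : P.natDegree ≠ 0 := by
    intro h0
    obtain ⟨p, rfl⟩ := natDegree_eq_zero.mp h0
    rw [aux_eval, eval₂_C] at hPe
    have := (map_eq_zero_iff _ hinj).mp hPe
    subst this
    exact hP.ne_zero (by simp)
  refine ⟨hdeg, ?_⟩
  have hprim := hP.isPrimitive hdeg
  have hirr := (hprim.irreducible_iff_irreducible_map_fraction_map (K := FractionRing K[X])).mp hP
  by_contra hnd
  have hnd' : ¬ (P.map (algebraMap K[X] (FractionRing K[X])) ∣
      G.map (algebraMap K[X] (FractionRing K[X]))) :=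
    fun h => hnd (hprim.dvd_of_fraction_map_dvd_fraction_map h)
  obtain ⟨u, v, huv⟩ := (hirr.coprime_iff_not_dvd).mpr hnd'
  have key : ∀ T : K[X][X], eval₂ (IsFractionRing.lift hinj : FractionRing K[X] →+* H) b
      (T.map (algebraMap K[X] (FractionRing K[X]))) = aevalAeval a b T := by
    intro T
    rw [aux_eval, eval₂_map]
    congr 1
    exact RingHom.ext fun z => by simp
  have := congrArg (eval₂ (IsFractionRing.lift hinj : FractionRing K[X] →+* H) b) huv
  rw [eval₂_add, eval₂_mul, eval₂_mul, key, key, hPe, hG] at this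
  simp at this

theorem aux_deriv_ne {K H : Type*} [Field K] [CharZero K] [Field H] [Algebra K H] (a b : H)
    (ha : Transcendental K a) (P : K[X][X]) (hP : Irreducible P)
    (hPe : aevalAeval a b P = 0) : aevalAeval a b (derivative P) ≠ 0 := by
  intro h
  obtain ⟨h0, hd⟩ := aux_dvd a b ha P _ hP hPe h
  have hlt := natDegree_derivative_lt h0
  have := eq_zero_of_dvd_of_natDegree_lt hd hlt
  exact h0 (derivative_eq_zero.mp this)

theorem aux_chain {K H : Type*} [Field K] [Field H] [Algebra K H] (P : K[X][X]) :
    ∃ S : K[X][X], ∀ (d : Derivation K H H) (a b : H), d (aevalAeval a b P) =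
      aevalAeval a b S * d a + aevalAeval a b (derivative P) * d b := by
  induction P using Polynomial.induction_on' with
  | add p q hp hq =>
    obtain ⟨S, hS⟩ := hp
    obtain ⟨T, hT⟩ := hq
    refine ⟨S + T, fun d a b => ?_⟩
    simp only [map_add, hS, hT]
    ring
  | monomial n p =>
    refine ⟨monomial n (derivative p), fun d a b => ?_⟩
    simp only [aux_eval, derivative_monomial, eval₂_monomial]
    simp only [AlgHom.toRingHom_eq_coe, RingHom.coe_coe, Derivation.leibniz, Derivation.leibniz_pow, map_mul, map_natCast,
      smul_eq_mul, nsmul_eq_mul]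
    have : d (aeval a p) = aeval a (derivative p) * d a := by
      rw [d.map_aeval, smul_eq_mul]
    rw [this]
    ring

theorem aux_coeffD {K H : Type*} [Field K] [Field H] [Algebra K H] (d : Derivation K H H)
    (L : IntermediateField K H) (hL : ∀ z ∈ L, d z ∈ L) (x : H) (hx : d x = 1) (p : L[X]) :
    ∃ r : L[X], (∀ n, (r.coeff n : H) = d (p.coeff n)) ∧
      d (aeval x p) = aeval x (r + derivative p) := by
  induction p using Polynomial.induction_on' with
  | add p q hp hq =>
    obtain ⟨r, hr, hr'⟩ := hp
    obtain ⟨s, hs, hs'⟩ := hq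
    refine ⟨r + s, fun n => by simp [hr, hs], ?_⟩
    simp only [map_add, hr', hs']
    ring
  | monomial n a =>
    refine ⟨monomial n ⟨d a, hL a a.2⟩, fun m => ?_, ?_⟩
    · simp only [coeff_monomial]
      split_ifs <;> simp
    · simp only [map_add, derivative_monomial, aeval_monomial, Derivation.leibniz,
        Derivation.leibniz_pow, hx, smul_eq_mul, nsmul_eq_mul, map_mul, map_natCast,
        IntermediateField.algebraMap_apply]
      ring

theorem aux_mem {K H : Type*} [Field K] [CharZero K] [Field H] [Algebra K H]
    (d : Derivation K H H) (hd : ∀ f, d f = 0 → ∃ c : K, f = algebraMap K H c)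
    (L : IntermediateField K H) (hL : ∀ z ∈ L, d z ∈ L) (x : H) (hx : d x = 1)
    (halg : IsAlgebraic L x) : x ∈ L := by
  have : CharZero H := charZero_of_injective_algebraMap (algebraMap K H).injective
  set p := minpoly L x with hp
  have hmon : p.Monic := minpoly.monic halg.isIntegral
  have hpos : 0 < p.natDegree := minpoly.natDegree_pos halg.isIntegral
  obtain ⟨r, hr, hr'⟩ := aux_coeffD d L hL x hx p
  rw [hp, minpoly.aeval, map_zero, ← hp] at hr'
  have hdeg : (r + derivative p).degree < p.degree := by
    rw [degree_eq_natDegree hmon.ne_zero, degree_lt_iff_coeff_zero]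
    intro m hm
    rw [coeff_add, coeff_derivative, coeff_eq_zero_of_natDegree_lt (n := m + 1) (by omega),
      zero_mul, add_zero]
    apply Subtype.ext
    rw [hr]
    rcases hm.eq_or_lt with h | h
    · rw [← h, hmon.coeff_natDegree]; simp
    · rw [coeff_eq_zero_of_natDegree_lt h]; simp
  have hz : r + derivative p = 0 := by
    by_contra hne
    exact absurd (minpoly.degree_le_of_ne_zero L x hne hr'.symm) (not_le.mpr hdeg)
  have hc := congrArg (fun q : L[X] => ((q.coeff (p.natDegree - 1) : L) : H)) hz
  obtain ⟨n, hn⟩ : ∃ n, p.natDegree = n + 1 := ⟨p.natDegree - 1, by omega⟩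
  have hlead : p.coeff (n + 1) = 1 := by rw [← hn]; exact hmon.coeff_natDegree
  simp only [hn, Nat.add_sub_cancel, coeff_add, coeff_derivative, hlead] at hc
  push_cast [hr] at hc
  have hn0 : ((n : H) + 1) ≠ 0 := by exact_mod_cast Nat.succ_ne_zero n
  have hn1 : ((n : H) + 1) ∈ L := add_mem (natCast_mem L n) (one_mem L)
  have hdn : d ((n : H) + 1) = 0 := by simp
  have hconst : d (((n : H) + 1) * x + p.coeff n) = 0 := by
    simp only [map_add, Derivation.leibniz, hx, smul_eq_mul, Derivation.map_natCast,
      Derivation.map_one_eq_zero]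
    simp at hc
    linear_combination hc
  obtain ⟨c, hc'⟩ := hd _ hconst
  have : x = (algebraMap K H c - p.coeff n) / ((n : H) + 1) := by
    rw [eq_div_iff hn0, ← hc']; ring
  rw [this]
  exact div_mem (sub_mem (L.algebraMap_mem c) (p.coeff n).2) hn1

theorem aux_frac.{u, v} {K B : Type u} {H : Type v} [Field K] [Field H] [Algebra K H] [CommRing B]
    [Algebra K B] (I : Ideal B) [I.IsPrime] :
    ∃ (E : Type u) (_ : Field E) (_ : Algebra K E) (ι : B → E),
      ∀ f : B →ₐ[K] H, (∀ T, f T = 0 ↔ T ∈ I) →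
      ∃ φ : E →ₐ[K] H, ∀ T, φ (ι T) = f T := by
  refine ⟨FractionRing (B ⧸ I), inferInstance, inferInstance,
    fun T => algebraMap (B ⧸ I) (FractionRing (B ⧸ I)) (Ideal.Quotient.mk I T), ?_⟩
  intro f hf
  have hinj : Function.Injective (Ideal.Quotient.liftₐ I f (fun T hT => (hf T).mpr hT)) := by
    rw [injective_iff_map_eq_zero]
    intro t ht
    obtain ⟨T, rfl⟩ := Ideal.Quotient.mk_surjective t
    rw [Ideal.Quotient.eq_zero_iff_mem]
    exact (hf T).mp ht
  refine ⟨IsFractionRing.liftAlgHom hinj, fun T => ?_⟩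
  rw [IsFractionRing.coe_liftAlgHom, IsFractionRing.lift_algebraMap]
  rfl

theorem aux_lift.{u, v} {K : Type u} {H : Type v} [Field K] [IsAlgClosed K] [Field H] [Algebra K H]
    (d : Derivation K H H) (F : K[X][X]) (hF : Irreducible F) :
    ∃ (E : Type u) (_ : Field E) (_ : Algebra K E) (ι : K[X][X] → E),
      ∀ y : H, d y ≠ 0 → aevalAeval y (d y) F = 0 →
      ∃ φ : E →ₐ[K] H, ∀ T : K[X][X], φ (ι T) = aevalAeval y (d y) T := by
  have hI : (Ideal.span {F}).IsPrime := (Ideal.span_singleton_prime hF.ne_zero).mpr hF.prime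
  obtain ⟨E, i1, i2, ι, hι⟩ := aux_frac (K := K) (H := H) (Ideal.span {F})
  refine ⟨E, i1, i2, ι, fun y hy h => hι _ fun T => ?_⟩
  rw [Ideal.mem_span_singleton]
  refine ⟨fun ht => (aux_dvd y (d y) (aux_transc d y hy) F T hF h ht).2, ?_⟩
  rintro ⟨U, rfl⟩
  rw [map_mul, h, zero_mul]

theorem aux_main {K H : Type*} [Field K] [IsAlgClosed K] [CharZero K] [Field H] [Algebra K H]
    (d : Derivation K H H) (hd : ∀ f, d f = 0 → ∃ c : K, f = algebraMap K H c)
    (x : H) (hx : d x = 1) (F : K[X][X]) (hF : Irreducible F) (y₁ y₂ : H)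
    (hy₁ : d y₁ ≠ 0) (hy₂ : d y₂ ≠ 0) (h₁ : aevalAeval y₁ (d y₁) F = 0)
    (h₂ : aevalAeval y₂ (d y₂) F = 0) (Q : K[X][X]) (hQ : Irreducible Q)
    (hQe : aevalAeval x y₁ Q = 0) :
    ∃ c : K, aevalAeval (x + algebraMap K H c) y₂ Q = 0 := by
  have t₁ := aux_transc d y₁ hy₁
  have t₂ := aux_transc d y₂ hy₂
  have tx := aux_transc d x (by rw [hx]; exact one_ne_zero)
  -- the differential field generated by the first solution
  let L : IntermediateField K H := IntermediateField.adjoin K {y₁, d y₁}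
  have hyL : y₁ ∈ L := IntermediateField.subset_adjoin _ _ (by simp)
  have hdyL : d y₁ ∈ L := IntermediateField.subset_adjoin _ _ (by simp)
  have hevL : ∀ T : K[X][X], aevalAeval y₁ (d y₁) T ∈ L := by
    intro T
    have : aevalAeval y₁ (d y₁) T = L.val (aevalAeval ⟨y₁, hyL⟩ ⟨d y₁, hdyL⟩ T) := by
      change _ = (L.val.comp (aevalAeval (⟨y₁, hyL⟩ : L) ⟨d y₁, hdyL⟩)) T
      congr 1
      exact algHom_ext' (by ext; simp) (by simp)
    rw [this]
    exact Subtype.property _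
  have hddyL : d (d y₁) ∈ L := by
    obtain ⟨S, hS⟩ := aux_chain (H := H) F
    have h := hS d y₁ (d y₁)
    rw [h₁, map_zero] at h
    have hne := aux_deriv_ne y₁ (d y₁) t₁ F hF h₁
    have : d (d y₁) = -(aevalAeval y₁ (d y₁) S * d y₁) / aevalAeval y₁ (d y₁) (derivative F) := by
      rw [eq_div_iff hne]; linear_combination -h
    rw [this]
    exact div_mem (neg_mem (mul_mem (hevL _) hdyL)) (hevL _)
  have hL : ∀ z ∈ L, d z ∈ L := by
    intro z hz
    induction hz using IntermediateField.adjoin_induction with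
    | mem z hz =>
      rcases hz with rfl | hz
      · exact hdyL
      · rw [Set.mem_singleton_iff.mp hz]; exact hddyL
    | algebraMap c => simp [zero_mem]
    | add a b _ _ ha hb => rw [map_add]; exact add_mem ha hb
    | inv a ha' ha =>
      rw [Derivation.leibniz_inv, smul_eq_mul]
      exact mul_mem (neg_mem (pow_mem (inv_mem ha') 2)) ha
    | mul a b ha' hb' ha hb =>
      rw [Derivation.leibniz, smul_eq_mul, smul_eq_mul]
      exact add_mem (mul_mem ha' hb) (mul_mem hb' ha)
  have halg : IsAlgebraic L x := by
    have tL : Transcendental K (⟨y₁, hyL⟩ : L) := by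
      intro h
      exact t₁ (h.algHom L.val)
    have hinj : Function.Injective (aeval (⟨y₁, hyL⟩ : L) : K[X] →ₐ[K] L).toRingHom :=
      transcendental_iff_injective.mp tL
    refine ⟨(Bivariate.swap Q).map (aeval (⟨y₁, hyL⟩ : L) : K[X] →ₐ[K] L).toRingHom, ?_, ?_⟩
    · rw [Ne, Polynomial.map_eq_zero_iff hinj]
      simpa using hQ.ne_zero
    · rw [aeval_def, eval₂_map]
      rw [← Bivariate.aevalAeval_swap, aux_eval] at hQe
      rw [← hQe]
      congr 1
      ext <;> simp
  have hxL : x ∈ L := aux_mem d hd L hL x hx halg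
  obtain ⟨E, _, _, ι, hlift⟩ := aux_lift d F hF
  obtain ⟨φ₁, hφ₁⟩ := hlift y₁ hy₁ h₁
  obtain ⟨φ₂, hφ₂⟩ := hlift y₂ hy₂ h₂
  let Y : E := ι (C X)
  let Z : E := ι X
  have hY₁ : φ₁ Y = y₁ := by rw [hφ₁, aevalAeval_X]
  have hY₂ : φ₂ Y = y₂ := by rw [hφ₂, aevalAeval_X]
  have hZ₁ : φ₁ Z = d y₁ := by rw [hφ₁, aevalAeval_Y]
  have hZ₂ : φ₂ Z = d y₂ := by rw [hφ₂, aevalAeval_Y]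
  have hle : L ≤ φ₁.fieldRange := by
    rw [IntermediateField.adjoin_le_iff]
    rintro z (rfl | hz)
    · exact ⟨Y, hY₁⟩
    · rw [Set.mem_singleton_iff.mp hz]; exact ⟨Z, hZ₁⟩
  obtain ⟨e, he⟩ := hle hxL
  replace he : φ₁ e = x := he
  have tr : ∀ (φ : E →ₐ[K] H) (T : K[X][X]),
      φ (aevalAeval e Y T) = aevalAeval (φ e) (φ Y) T := by
    intro φ T
    change (φ.comp (aevalAeval e Y)) T = _
    congr 1
    exact algHom_ext' (by ext; simp) (by simp)
  obtain ⟨S, hS⟩ := aux_chain (H := H) Q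
  have a1 := hS d x y₁
  rw [hQe, map_zero, hx, mul_one] at a1
  have hne1 := aux_deriv_ne x y₁ tx Q hQ hQe
  have hSne : aevalAeval x y₁ S ≠ 0 := by
    intro h0
    rw [h0, zero_add] at a1
    exact mul_ne_zero hne1 hy₁ a1.symm
  have b0 : aevalAeval e Y Q = 0 := by
    apply (show Function.Injective φ₁ from φ₁.toRingHom.injective)
    rw [tr, he, hY₁, hQe, map_zero]
  have b1 : aevalAeval e Y S + aevalAeval e Y (derivative Q) * Z = 0 := by
    apply (show Function.Injective φ₁ from φ₁.toRingHom.injective)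
    rw [map_add, map_mul, tr, tr, he, hY₁, hZ₁, map_zero, ← a1]
  have b2 : aevalAeval e Y S ≠ 0 := by
    intro h0
    apply hSne
    rw [← he, ← hY₁, ← tr, h0, map_zero]
  have c0 : aevalAeval (φ₂ e) y₂ Q = 0 := by
    rw [← hY₂, ← tr, b0, map_zero]
  have c1 : aevalAeval (φ₂ e) y₂ S + aevalAeval (φ₂ e) y₂ (derivative Q) * d y₂ = 0 := by
    rw [← hZ₂, ← hY₂, ← tr, ← tr, ← map_mul, ← map_add, b1, map_zero]
  have c2 : aevalAeval (φ₂ e) y₂ S ≠ 0 := by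
    rw [← hY₂, ← tr]
    exact (map_ne_zero_iff _ φ₂.injective).mpr b2
  have c3 := hS d (φ₂ e) y₂
  rw [c0, map_zero] at c3
  have c4 : aevalAeval (φ₂ e) y₂ S * (d (φ₂ e) - 1) = 0 := by
    linear_combination - c3 - c1
  have c5 : d (φ₂ e - x) = 0 := by
    rw [map_sub, hx]
    exact (mul_eq_zero.mp c4).resolve_left c2
  obtain ⟨c, hc⟩ := hd _ c5
  refine ⟨c, ?_⟩
  rw [← hc, add_sub_cancel, c0]

theorem aux_main' {K H : Type*} [Field K] [IsAlgClosed K] [CharZero K] [Field H] [Algebra K H]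
    (δ : H → H) (hadd : ∀ f g, δ (f + g) = δ f + δ g) (hmul : ∀ f g, δ (f * g) = δ f * g + f * δ g)
    (hc : ∀ c : K, δ (algebraMap K H c) = 0)
    (hd : ∀ f, δ f = 0 → ∃ c : K, f = algebraMap K H c)
    (x : H) (hx : δ x = 1) (F : MvPolynomial (Fin 2) K) (hF : Irreducible F) (y₁ y₂ : H)
    (hy₁ : ∀ c, y₁ ≠ algebraMap K H c) (hy₂ : ∀ c, y₂ ≠ algebraMap K H c)
    (h₁ : MvPolynomial.aeval ![y₁, δ y₁] F = 0)
    (h₂ : MvPolynomial.aeval ![y₂, δ y₂] F = 0) (Q₁ Q₂ : K[X][X]) (hQ₁ : Irreducible Q₁)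
    (hQ₂ : Irreducible Q₂) (hm₁ : Q₁.Monic) (hm₂ : Q₂.Monic)
    (hQe₁ : eval₂ (aeval x).toRingHom y₁ Q₁ = 0) (hQe₂ : eval₂ (aeval x).toRingHom y₂ Q₂ = 0) :
    ∃ c : K, Q₁ = Q₂.map (aeval (X + C c)).toRingHom := by
  let d : Derivation K H H := Derivation.mk'
    { toFun := δ
      map_add' := hadd
      map_smul' := fun c f => by simp [Algebra.smul_def, hmul, hc] }
    (fun f g => by
      change δ (f * g) = f • δ g + g • δ f
      rw [hmul, smul_eq_mul, smul_eq_mul]; ring)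
  have hdδ : ∀ f, d f = δ f := fun _ => rfl
  let e : MvPolynomial (Fin 2) K ≃ₐ[K] K[X][X] := AlgEquiv.ofAlgHom
    (MvPolynomial.aeval ![C X, X])
    (aevalAeval (MvPolynomial.X 0) (MvPolynomial.X 1))
    (algHom_ext' (by ext; simp) (by simp))
    (by ext i; fin_cases i <;> simp)
  have hev : ∀ a b : H, ∀ T, aevalAeval a b (e T) = MvPolynomial.aeval ![a, b] T := by
    intro a b T
    change ((aevalAeval a b).comp (MvPolynomial.aeval ![C X, X])) T = _
    congr 1
    ext i
    fin_cases i <;> simp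
  have hFe : Irreducible (e F) := (MulEquiv.irreducible_iff e).mpr hF
  have n₁ : d y₁ ≠ 0 := fun h => by
    obtain ⟨c, hc⟩ := hd _ h
    exact hy₁ c hc
  have n₂ : d y₂ ≠ 0 := fun h => by
    obtain ⟨c, hc⟩ := hd _ h
    exact hy₂ c hc
  obtain ⟨c, hcc⟩ := aux_main d hd x hx (e F) hFe y₁ y₂ n₁ n₂ (by rw [hev]; exact h₁)
    (by rw [hev]; exact h₂) Q₁ hQ₁ (by rw [aux_eval]; exact hQe₁)
  have tx := aux_transc d x (by rw [hdδ, hx]; exact one_ne_zero)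
  have hcomp : ∀ T : K[X][X], aevalAeval x y₂ (T.map (aeval (X + C c)).toRingHom) =
      aevalAeval (x + algebraMap K H c) y₂ T := by
    intro T
    rw [aux_eval, aux_eval, eval₂_map]
    congr 1
    ext <;> simp
  have hdvd := (aux_dvd x y₂ tx Q₂ (Q₁.map (aeval (X + C c)).toRingHom) hQ₂
    (by rw [aux_eval]; exact hQe₂) (by rw [hcomp]; exact hcc)).2
  have hback : (Q₁.map (aeval (X + C c)).toRingHom).map (aeval (X + C (-c))).toRingHom = Q₁ := by
    rw [map_map]
    conv_rhs => rw [← Polynomial.map_id (p := Q₁)]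
    congr 1
    ext <;> simp
  have hdvd' := Polynomial.map_dvd (aeval (X + C (-c)) : K[X] →ₐ[K] K[X]).toRingHom hdvd
  rw [hback] at hdvd'
  refine ⟨-c, ?_⟩
  have hm := hm₂.map (aeval (X + C (-c)) : K[X] →ₐ[K] K[X]).toRingHom
  refine (eq_of_monic_of_associated hm hm₁ ?_).symm
  refine ((hQ₁.dvd_iff.mp hdvd').resolve_left ?_).symm
  intro hu
  have h1 := hm.eq_one_of_isUnit hu
  have h2 : Q₂.natDegree = 0 := by
    rw [← hm₂.natDegree_map (aeval (X + C (-c)) : K[X] →ₐ[K] K[X]).toRingHom, h1, natDegree_one]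
  exact hQ₂.not_isUnit (by rw [hm₂.natDegree_eq_zero.mp h2]; exact isUnit_one)

end AuxAlg

section AuxHahn

noncomputable def auxTheta {K : Type*} [Field K] [CharZero K] (f : HahnSeries ℚ K) :
    HahnSeries ℚ K where
  coeff q := q • f.coeff q
  isPWO_support' := f.isPWO_support.mono (by
    intro q hq h
    simp [Function.mem_support, h] at hq)

theorem auxTheta_supp {K : Type*} [Field K] [CharZero K] (f : HahnSeries ℚ K) :
    (auxTheta f).support ⊆ f.support := by
  intro q hq h
  exact hq (by simp [auxTheta, h])

theorem auxTheta_mul {K : Type*} [Field K] [CharZero K] (f g : HahnSeries ℚ K) :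
    auxTheta (f * g) = auxTheta f * g + f * auxTheta g := by
  ext q
  rw [HahnSeries.coeff_add, HahnSeries.coeff_mul_left' f.isPWO_support (auxTheta_supp f),
    HahnSeries.coeff_mul_right' g.isPWO_support (auxTheta_supp g), ← Finset.sum_add_distrib]
  change q • (f * g).coeff q = _
  rw [HahnSeries.coeff_mul, Finset.smul_sum]
  refine Finset.sum_congr rfl fun ij hij => ?_
  have h : ij.1 + ij.2 = q := by
    simp at hij
    tauto
  simp only [auxTheta, ← h, add_smul, smul_mul_assoc, mul_smul_comm]

theorem pDeriv_eq {K : Type*} [Field K] [CharZero K] (f : HahnSeries ℚ K) :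
    pDeriv f = HahnSeries.single (-1 : ℚ) 1 * auxTheta f := by
  ext q
  rw [HahnSeries.coeff_single_mul]
  simp [pDeriv, auxTheta]

theorem auxD_alg {K : Type*} [Field K] (c : K) :
    algebraMap K (HahnSeries ℚ K) c = HahnSeries.C c := by
  rw [HahnSeries.algebraMap_apply']
  simp

theorem auxD_const {K : Type*} [Field K] [CharZero K] (f : HahnSeries ℚ K) (h : pDeriv f = 0) :
    f = HahnSeries.C (f.coeff 0) := by
  ext q
  rw [HahnSeries.C_apply]
  by_cases hq : q = 0
  · subst hq; simp
  · rw [HahnSeries.coeff_single_of_ne hq]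
    have := congrArg (fun g => g.coeff (q - 1)) h
    simpa [pDeriv, hq] using this

theorem auxD_C {K : Type*} [Field K] [CharZero K] (c : K) :
    pDeriv (HahnSeries.C c : HahnSeries ℚ K) = 0 := by
  ext q
  simp only [pDeriv, HahnSeries.C_apply]
  by_cases hq : q + 1 = 0
  · simp [hq]
  · rw [HahnSeries.coeff_single_of_ne hq]; simp

theorem auxD_X {K : Type*} [Field K] [CharZero K] : pDeriv (Xser K) = 1 := by
  ext q
  simp only [pDeriv, Xser, HahnSeries.coeff_one]
  by_cases hq : q = 0
  · subst hq; simp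
  · rw [HahnSeries.coeff_single_of_ne (by simpa using hq)]; simp [hq]

end AuxHahn

theorem statement4 {K : Type*} [Field K] [IsAlgClosed K] [CharZero K]
    (F : MvPolynomial (Fin 2) K) (hF : Irreducible F)
    (y₁ y₂ : HahnSeries ℚ K) (hy₁ : IsPuiseux y₁) (hy₂ : IsPuiseux y₂)
    (hnc₁ : ∀ c : K, y₁ ≠ HahnSeries.C c) (hnc₂ : ∀ c : K, y₂ ≠ HahnSeries.C c)
    (hsol₁ : MvPolynomial.aeval ![y₁, pDeriv y₁] F = 0)
    (hsol₂ : MvPolynomial.aeval ![y₂, pDeriv y₂] F = 0)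
    (Q₁ Q₂ : Polynomial (Polynomial K))
    (hQ₁ : IsMinPolyOf Q₁ y₁) (hQ₂ : IsMinPolyOf Q₂ y₂) :
    ∃ c : K, Q₁ = Q₂.map (Polynomial.aeval (Polynomial.X + Polynomial.C c)).toRingHom := by
  refine aux_main' (δ := pDeriv) ?_ ?_ ?_ ?_ (Xser K) auxD_X F hF y₁ y₂ ?_ ?_ hsol₁ hsol₂ Q₁ Q₂
    hQ₁.2.1 hQ₂.2.1 hQ₁.1 hQ₂.1 hQ₁.2.2 hQ₂.2.2
  · intro f g
    ext q
    simp [pDeriv]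
  · intro f g
    simp only [pDeriv_eq, auxTheta_mul]
    ring
  · intro c
    rw [auxD_alg, auxD_C]
  · intro f hf
    exact ⟨_, by rw [auxD_alg]; exact auxD_const f hf⟩
  · intro c
    rw [auxD_alg]; exact hnc₁ c
  · intro c
    rw [auxD_alg]; exact hnc₂ c
end
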